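/- Let n ≥ 3, λ ≥ 0, ϝ ∈ ℝ with ((n−2)/2)² + λ + ϝ > 0, and set s = √(((n−2)/2)² + λ + ϝ). Let σ ∈ ℂ, let ε ∈ {+1, −1}, and set α = −(n−2)/2 + εs, a = 1/2 + εs, b = 1/2 + εs + iσ, c = 1 + 2εs. Then for any twice continuously differentiable w : (0,1) → ℂ, writing y(x) = x^{−α} w(x), the function w satisfies the radial equation with parameters (n,σ,λ,ϝ), namely x(1−x)w''(x) + (n−1 − x(n+iσ))w'(x) − ((ϝ+λ)/x)w(x) − ((n−1)/2)(iσ + (n−1)/2)w(x) = 0 on (0,1), if and only if y satisfies the hypergeometric equation with parameters (a,b,c), namely x(1−x)y''(x) + (c − (a+b+1)x)y'(x) − a b y(x) = 0 on (0,1). -/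

import Mathlib

/-- The radial (reduced normal operator) equation with parameters `(n, σ, λ, ϝ)`:
`x(1−x)w'' + (n−1 − x(n+iσ))w' − ((ϝ+λ)/x)w − ((n−1)/2)(iσ + (n−1)/2)w = 0`. -/
def radialEq (n : ℕ) (σ : ℂ) (lam ϝ : ℝ) (w : ℝ → ℂ) (x : ℝ) : Prop :=
  (x : ℂ) * (1 - (x : ℂ)) * deriv (deriv w) x
    + ((n : ℂ) - 1 - (x : ℂ) * ((n : ℂ) + Complex.I * σ)) * deriv w x
    - ((ϝ : ℂ) + (lam : ℂ)) / (x : ℂ) * w x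
    - ((n : ℂ) - 1) / 2 * (Complex.I * σ + ((n : ℂ) - 1) / 2) * w x = 0

/-- The Gauss hypergeometric equation with parameters `(a, b, c)`:
`x(1−x)y'' + (c − (a+b+1)x)y' − a b y = 0`. -/
def hypergeomEq (a b c : ℂ) (y : ℝ → ℂ) (x : ℝ) : Prop :=
  (x : ℂ) * (1 - (x : ℂ)) * deriv (deriv y) x
    + (c - (a + b + 1) * (x : ℂ)) * deriv y x - a * b * y x = 0

/-- Conjugation by the indicial power `x^α`, `α = −(n−2)/2 + εs`, transforms the radial
reduced-normal-operator equation into the hypergeometric equation with parameters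
`a = 1/2 + εs`, `b = 1/2 + εs + iσ`, `c = 1 + 2εs`. -/
theorem stmt6 (n : ℕ) (hn : 3 ≤ n) (lam ϝ : ℝ) (hlam : 0 ≤ lam)
    (hpos : 0 < (((n : ℝ) - 2) / 2) ^ 2 + lam + ϝ)
    (s : ℝ) (hs : s = Real.sqrt ((((n : ℝ) - 2) / 2) ^ 2 + lam + ϝ))
    (σ : ℂ) (ε : ℝ) (hε : ε = 1 ∨ ε = -1)
    (α : ℝ) (hα : α = -(((n : ℝ) - 2) / 2) + ε * s)
    (a b c : ℂ)
    (ha : a = 1 / 2 + ((ε * s : ℝ) : ℂ))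
    (hb : b = 1 / 2 + ((ε * s : ℝ) : ℂ) + Complex.I * σ)
    (hc : c = 1 + 2 * ((ε * s : ℝ) : ℂ))
    (w : ℝ → ℂ) (hw : ContDiffOn ℝ 2 w (Set.Ioo 0 1))
    (y : ℝ → ℂ) (hy : ∀ x : ℝ, y x = ((x ^ (-α) : ℝ) : ℂ) * w x) :
    (∀ x ∈ Set.Ioo (0 : ℝ) 1, radialEq n σ lam ϝ w x)
      ↔ (∀ x ∈ Set.Ioo (0 : ℝ) 1, hypergeomEq a b c y x) := by
  have hopen : IsOpen (Set.Ioo (0 : ℝ) 1) := isOpen_Ioo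
  have hw1 : ∀ x ∈ Set.Ioo (0 : ℝ) 1, HasDerivAt w (deriv w x) x := fun x hx =>
    ((hw.differentiableOn (by norm_num)).differentiableAt (hopen.mem_nhds hx)).hasDerivAt
  have hdw : ContDiffOn ℝ 1 (deriv w) (Set.Ioo 0 1) :=
    ((contDiffOn_succ_iff_deriv_of_isOpen (n := 1) hopen).1 (by simpa [one_add_one_eq_two] using hw)).2.2
  have hw2 : ∀ x ∈ Set.Ioo (0 : ℝ) 1, HasDerivAt (deriv w) (deriv (deriv w) x) x := fun x hx =>
    ((hdw.differentiableOn (by norm_num)).differentiableAt (hopen.mem_nhds hx)).hasDerivAt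
  have hp : ∀ x ∈ Set.Ioo (0 : ℝ) 1, HasDerivAt (fun t : ℝ => ((t ^ (-α) : ℝ) : ℂ))
      (-(α : ℂ) * ((x ^ (-α) : ℝ) : ℂ) / (x : ℂ)) x := by
    intro x hx
    have h := (Real.hasDerivAt_rpow_const (x := x) (p := -α) (Or.inl hx.1.ne')).ofReal_comp
    convert h using 1
    rw [Real.rpow_sub_one hx.1.ne']
    push_cast
    ring
  have hy' : y = fun x : ℝ => ((x ^ (-α) : ℝ) : ℂ) * w x := funext hy
  have hy1 : ∀ x ∈ Set.Ioo (0 : ℝ) 1, deriv y x =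
      ((x ^ (-α) : ℝ) : ℂ) * (deriv w x - α * (w x / x)) := by
    intro x hx
    rw [hy']
    refine (((hp x hx).mul (hw1 x hx)).deriv).trans ?_
    ring
  have hy2 : ∀ x ∈ Set.Ioo (0 : ℝ) 1, deriv (deriv y) x =
      ((x ^ (-α) : ℝ) : ℂ) * (deriv (deriv w) x - 2 * α * deriv w x / x
        + α * (α + 1) * w x / x ^ 2) := by
    intro x hx
    have hx0 : (x : ℂ) ≠ 0 := by exact_mod_cast hx.1.ne'
    have he : deriv y =ᶠ[nhds x] fun x : ℝ =>
        ((x ^ (-α) : ℝ) : ℂ) * (deriv w x - α * (w x / x)) := by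
      filter_upwards [hopen.mem_nhds hx] with t ht using hy1 t ht
    rw [he.deriv_eq]
    have hid : HasDerivAt (fun t : ℝ => (t : ℂ)) 1 x := by
      simpa using (hasDerivAt_id x).ofReal_comp
    refine (((hp x hx).mul ((hw2 x hx).sub
      (((hw1 x hx).div hid hx0).const_mul (α : ℂ)))).deriv).trans ?_
    simp only [Pi.sub_apply, Pi.div_apply]
    field_simp
    ring
  have hss : (ε * s) ^ 2 = (((n : ℝ) - 2) / 2) ^ 2 + lam + ϝ := by
    have h1 : ε ^ 2 = 1 := by rcases hε with h | h <;> rw [h] <;> norm_num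
    rw [mul_pow, h1, one_mul, hs, Real.sq_sqrt hpos.le]
  have hF : ϝ = (ε * s) ^ 2 - (((n : ℝ) - 2) / 2) ^ 2 - lam := by linarith
  refine forall₂_congr fun x hx => ?_
  have hx0 : (x : ℂ) ≠ 0 := by exact_mod_cast hx.1.ne'
  have hp0 : ((x ^ (-α) : ℝ) : ℂ) ≠ 0 := by
    exact_mod_cast (Real.rpow_pos_of_pos hx.1 _).ne'
  unfold radialEq hypergeomEq
  rw [hy1 x hx, hy2 x hx, hy x]
  generalize ((x ^ (-α) : ℝ) : ℂ) = p at hp0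
  rw [← mul_right_inj' hp0, mul_zero]
  refine Eq.congr ?_ rfl
  rw [ha, hb, hc, hF, hα]
  generalize ε * s = t
  push_cast
  field_simp
  ring
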